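/- Let N be a positive integer, 0 < s < 1 with N > 2s, α > -2s and 1 < p < (N + 2α + 2s)/(N - 2s). Let u be an admissible positive solution of the Hénon equation, and suppose the set M := {μ > 0 : u_λ(x) ≥ u(x) for all 0 < λ < μ and all x with 0 < |x| < λ} is nonempty with λ̃ := sup M < ∞. Then u_{λ̃}(x) = u(x) for every x with 0 < |x| < λ̃. -/

import Mathlib

open MeasureTheory Filter Set

/-- The principal-value fractional Laplacian: `IsFracLapAt N s u x L` means that
`lim_{ε→0⁺} ∫_{|y-x|>ε} (u(x)-u(y))/|x-y|^{N+2s} dy` exists and equals `L`. -/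
def IsFracLapAt (N : ℕ) (s : ℝ) (u : EuclideanSpace ℝ (Fin N) → ℝ)
    (x : EuclideanSpace ℝ (Fin N)) (L : ℝ) : Prop :=
  Filter.Tendsto (fun ε : ℝ =>
      ∫ y in {y : EuclideanSpace ℝ (Fin N) | ε < ‖y - x‖},
        (u x - u y) / ‖x - y‖ ^ ((N : ℝ) + 2 * s))
    (nhdsWithin 0 (Set.Ioi 0)) (nhds L)

/-- The Kelvin transform `u_λ(x) = (λ/|x|)^{N-2s} u(λ²x/|x|²)`. -/
noncomputable def kelvinTransform (N : ℕ) (s lam : ℝ)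
    (u : EuclideanSpace ℝ (Fin N) → ℝ) (x : EuclideanSpace ℝ (Fin N)) : ℝ :=
  (lam / ‖x‖) ^ ((N : ℝ) - 2 * s) * u ((lam ^ 2 / ‖x‖ ^ 2) • x)

/-- `u` is `C^{1,1}` on a neighbourhood of `x`. -/
def C11Near (N : ℕ) (u : EuclideanSpace ℝ (Fin N) → ℝ)
    (x : EuclideanSpace ℝ (Fin N)) : Prop :=
  ∃ ε > 0, ContDiffOn ℝ 1 u (Metric.ball x ε) ∧
    ∃ K : NNReal, LipschitzOnWith K (fderiv ℝ u) (Metric.ball x ε)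

/-- `u` is an admissible positive solution of the Hénon equation
`(-Δ)^s u = |x|^α u^p`: it is positive, continuous, locally bounded, lies in `L_{2s}`,
is `C^{1,1}` near every point of `ℝ^N \ {0}`, solves the equation pointwise away from
the origin and satisfies the equivalent integral equation. -/
def AdmissiblePositiveSolution (N : ℕ) (s α p : ℝ)
    (u : EuclideanSpace ℝ (Fin N) → ℝ) : Prop :=
  Continuous u ∧ (∀ x, 0 < u x) ∧
  (∀ R : ℝ, ∃ C : ℝ, ∀ x : EuclideanSpace ℝ (Fin N), ‖x‖ ≤ R → u x ≤ C) ∧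
  Integrable (fun y : EuclideanSpace ℝ (Fin N) =>
    |u y| / (1 + ‖y‖ ^ ((N : ℝ) + 2 * s))) ∧
  (∀ x : EuclideanSpace ℝ (Fin N), x ≠ 0 → C11Near N u x) ∧
  (∀ x : EuclideanSpace ℝ (Fin N), x ≠ 0 →
    ∃ L : ℝ, IsFracLapAt N s u x L ∧ L = ‖x‖ ^ α * u x ^ p) ∧
  (∀ x : EuclideanSpace ℝ (Fin N),
    Integrable (fun y : EuclideanSpace ℝ (Fin N) =>
      ‖y‖ ^ α * u y ^ p / ‖x - y‖ ^ ((N : ℝ) - 2 * s)) ∧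
    u x = ∫ y : EuclideanSpace ℝ (Fin N),
      ‖y‖ ^ α * u y ^ p / ‖x - y‖ ^ ((N : ℝ) - 2 * s))

section Inversion

open EuclideanGeometry Metric

variable {E : Type*} [NormedAddCommGroup E] [InnerProductSpace ℝ E]

/-- The quantity `‖x‖ ‖x* - y‖ / lam`, where `x*` is the inversion of `x` in the sphere of radius
`lam` about the origin. -/
noncomputable def reflDist (lam : ℝ) (x y : E) : ℝ :=
  ‖x‖ * ‖inversion 0 lam x - y‖ / lam

theorem inversion_zero_eq_smul (lam : ℝ) (x : E) :
    inversion 0 lam x = (lam ^ 2 / ‖x‖ ^ 2) • x := by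
  simp [inversion, div_pow]

theorem norm_inversion_zero (lam : ℝ) (x : E) :
    ‖inversion 0 lam x‖ = lam ^ 2 / ‖x‖ := by
  simpa using dist_inversion_center (0 : E) x lam

theorem inversion_zero_ne_zero {lam : ℝ} (hlam : 0 < lam) {x : E} (hx : x ≠ 0) :
    inversion 0 lam x ≠ 0 := by
  rw [← norm_pos_iff, norm_inversion_zero]
  have := norm_pos_iff.2 hx
  positivity

theorem reflDist_nonneg {lam : ℝ} (hlam : 0 < lam) (x y : E) : 0 ≤ reflDist lam x y := by
  unfold reflDist; positivity

theorem reflDist_sq {lam : ℝ} (hlam : 0 < lam) {x : E} (hx : x ≠ 0) (y : E) :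
    reflDist lam x y ^ 2 =
      ‖x - y‖ ^ 2 + (lam ^ 2 - ‖x‖ ^ 2) * (lam ^ 2 - ‖y‖ ^ 2) / lam ^ 2 := by
  have hx' := norm_pos_iff.2 hx
  rw [reflDist, div_pow, mul_pow, @norm_sub_sq_real, @norm_sub_sq_real, norm_inversion_zero,
    inversion_zero_eq_smul, real_inner_smul_left]
  field_simp
  ring

theorem reflDist_comm {lam : ℝ} (hlam : 0 < lam) {x y : E} (hx : x ≠ 0) (hy : y ≠ 0) :
    reflDist lam x y = reflDist lam y x := by
  rw [← sq_eq_sq₀ (reflDist_nonneg hlam x y) (reflDist_nonneg hlam y x), reflDist_sq hlam hx,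
    reflDist_sq hlam hy, norm_sub_rev y x]
  ring

theorem reflDist_inversion {lam : ℝ} (hlam : 0 < lam) (x y : E) :
    reflDist lam (inversion 0 lam x) y = lam / ‖x‖ * ‖x - y‖ := by
  rw [reflDist, norm_inversion_zero, inversion_inversion _ hlam.ne']
  field_simp

theorem norm_inversion_sub {lam : ℝ} (hlam : 0 < lam) {x : E} (hx : x ≠ 0) (y : E) :
    ‖inversion 0 lam x - y‖ = lam / ‖x‖ * reflDist lam x y := by
  have hx' := norm_pos_iff.2 hx
  rw [reflDist]
  field_simp

theorem norm_sub_le_reflDist {lam : ℝ} (hlam : 0 < lam) {x y : E} (hx : x ≠ 0)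
    (hxl : ‖x‖ ≤ lam) (hyl : ‖y‖ ≤ lam) : ‖x - y‖ ≤ reflDist lam x y := by
  rw [← sq_le_sq₀ (norm_nonneg _) (reflDist_nonneg hlam x y), reflDist_sq hlam hx]
  have h1 : 0 ≤ lam ^ 2 - ‖x‖ ^ 2 := by nlinarith [norm_nonneg x]
  have h2 : 0 ≤ lam ^ 2 - ‖y‖ ^ 2 := by nlinarith [norm_nonneg y]
  have : 0 ≤ (lam ^ 2 - ‖x‖ ^ 2) * (lam ^ 2 - ‖y‖ ^ 2) / lam ^ 2 := by positivity
  linarith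

theorem inversion_image_ball {lam : ℝ} (hlam : 0 < lam) :
    inversion (0 : E) lam '' (ball 0 lam \ {0}) = (closedBall 0 lam)ᶜ := by
  ext y
  simp only [mem_image, Set.mem_sdiff, mem_ball, dist_zero_right, mem_singleton_iff, mem_compl_iff,
    mem_closedBall, not_le]
  constructor
  · rintro ⟨x, ⟨hx, hx0⟩, rfl⟩
    have hx' := norm_pos_iff.2 hx0
    rw [norm_inversion_zero, lt_div_iff₀ hx']
    nlinarith
  · intro hy
    have hy0 : y ≠ 0 := norm_pos_iff.1 (hlam.trans hy)
    refine ⟨inversion 0 lam y, ⟨?_, inversion_zero_ne_zero hlam hy0⟩,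
      inversion_inversion _ hlam.ne' y⟩
    rw [norm_inversion_zero, div_lt_iff₀ (hlam.trans hy)]
    nlinarith

theorem kernel_sub_nonneg {n lam : ℝ} (hn : 0 ≤ n) (hlam : 0 < lam) {x y : E} (hx : x ≠ 0)
    (hxl : ‖x‖ ≤ lam) (hyl : ‖y‖ ≤ lam) (hxy : x ≠ y) :
    0 ≤ 1 / ‖x - y‖ ^ n - 1 / reflDist lam x y ^ n := by
  have h : 0 < ‖x - y‖ := norm_pos_iff.2 (sub_ne_zero.2 hxy)
  have := Real.rpow_le_rpow h.le (norm_sub_le_reflDist hlam hx hxl hyl) hn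
  rw [sub_nonneg]
  exact one_div_le_one_div_of_le (Real.rpow_pos_of_pos h n) this

theorem exists_pos_le_kernel_sub {n lam r : ℝ} (hn : 0 < n) (hr : 0 ≤ r) (hrl : r < lam) :
    ∃ c > 0, ∀ x y : E, x ≠ 0 → ‖x‖ ≤ r → ‖y‖ ≤ r → x ≠ y →
      c ≤ 1 / ‖x - y‖ ^ n - 1 / reflDist lam x y ^ n := by
  have hlam : 0 < lam := hr.trans_lt hrl
  set d := (lam ^ 2 - r ^ 2) * (lam ^ 2 - r ^ 2) / lam ^ 2 with hd
  have hr2 : 0 < lam ^ 2 - r ^ 2 := by nlinarith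
  have hdpos : 0 < d := by positivity
  set q := √(1 + d / (2 * lam) ^ 2) with hq
  have hq2 : q ^ 2 = 1 + d / (2 * lam) ^ 2 := Real.sq_sqrt (by positivity)
  have hq1 : 1 < q := by
    rw [hq, Real.lt_sqrt one_pos.le]
    have : 0 < d / (2 * lam) ^ 2 := by positivity
    linarith
  have hqn : 1 < q ^ n := Real.one_lt_rpow hq1 hn
  have hqn' : 0 < 1 - 1 / q ^ n := by
    rw [sub_pos, div_lt_one (by linarith)]; exact hqn
  refine ⟨(1 - 1 / q ^ n) / (2 * lam) ^ n, by positivity, fun x y hx hxr hyr hxy => ?_⟩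
  have h : 0 < ‖x - y‖ := norm_pos_iff.2 (sub_ne_zero.2 hxy)
  have hle : ‖x - y‖ ≤ 2 * lam := (norm_sub_le x y).trans (by linarith)
  have hD : q * ‖x - y‖ ≤ reflDist lam x y := by
    rw [← sq_le_sq₀ (by positivity) (reflDist_nonneg hlam x y), reflDist_sq hlam hx, mul_pow, hq2]
    have h1 : lam ^ 2 - r ^ 2 ≤ lam ^ 2 - ‖x‖ ^ 2 := by nlinarith [norm_nonneg x]
    have h2 : lam ^ 2 - r ^ 2 ≤ lam ^ 2 - ‖y‖ ^ 2 := by nlinarith [norm_nonneg y]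
    have h3 : d ≤ (lam ^ 2 - ‖x‖ ^ 2) * (lam ^ 2 - ‖y‖ ^ 2) / lam ^ 2 := by
      have h5 := hr2.le.trans h1
      rw [hd]; gcongr
    have h4 : d / (2 * lam) ^ 2 * ‖x - y‖ ^ 2 ≤ d := by
      rw [div_mul_eq_mul_div, div_le_iff₀ (by positivity)]
      gcongr
    linarith
  have hDn := Real.rpow_le_rpow (by positivity) hD hn.le
  rw [Real.mul_rpow (by positivity) h.le] at hDn
  have hk : 0 < ‖x - y‖ ^ n := Real.rpow_pos_of_pos h n
  calc (1 - 1 / q ^ n) / (2 * lam) ^ n ≤ (1 - 1 / q ^ n) / ‖x - y‖ ^ n := by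
        gcongr
    _ = 1 / ‖x - y‖ ^ n - 1 / (q ^ n * ‖x - y‖ ^ n) := by field_simp
    _ ≤ _ := by gcongr

/-- The density obtained from `f` by the Kelvin transform: if `v` is the potential of `f` with
kernel `‖x - y‖ ^ (-n)`, then its Kelvin transform is the potential of `kelvinDensity n lam f`. -/
noncomputable def kelvinDensity (n lam : ℝ) (f : E → ℝ) (z : E) : ℝ :=
  (lam / ‖z‖) ^ (2 * (Module.finrank ℝ E : ℝ) - n) * f (inversion 0 lam z)

theorem inversion_pullback_potential {n lam : ℝ} (hlam : 0 < lam) (f : E → ℝ) {x z : E}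
    (hx : x ≠ 0) (hz : z ≠ 0) :
    (lam / ‖z‖) ^ (2 * Module.finrank ℝ E) *
      (f (inversion 0 lam z) / ‖x - inversion 0 lam z‖ ^ n) =
      kelvinDensity n lam f z / reflDist lam x z ^ n := by
  have hz' := norm_pos_iff.2 hz
  have h : 0 < lam / ‖z‖ := by positivity
  rw [norm_sub_rev, norm_inversion_sub hlam hz, reflDist_comm hlam hz hx,
    Real.mul_rpow h.le (reflDist_nonneg hlam x z), kelvinDensity, Real.rpow_sub h,
    ← Real.rpow_natCast]
  push_cast
  field_simp

theorem continuousAt_kelvinDensity {n lam : ℝ} (hlam : 0 < lam) {f : E → ℝ}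
    (hf : ∀ y, y ≠ 0 → ContinuousAt f y) {z : E} (hz : z ≠ 0) :
    ContinuousAt (kelvinDensity n lam f) z := by
  have h0 : ‖z‖ ≠ 0 := norm_ne_zero_iff.2 hz
  have hi : ContinuousAt (inversion 0 lam) z :=
    (hasFDerivAt_inversion (R := lam) hz).continuousAt
  unfold kelvinDensity
  refine ContinuousAt.mul (ContinuousAt.rpow_const ?_ (Or.inl (by positivity)))
    (ContinuousAt.comp (hf _ (inversion_zero_ne_zero hlam hz)) hi)
  fun_prop (disch := assumption)

variable [FiniteDimensional ℝ E]

theorem abs_det_fderiv_inversion (lam : ℝ) (x : E) :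
    |(((lam / dist x 0) ^ 2 •
      ((ℝ ∙ (x - 0))ᗮ.reflection : E →L[ℝ] E)) : E →L[ℝ] E).det| =
      (lam / ‖x‖) ^ (2 * Module.finrank ℝ E) := by
  have h : LinearMap.det (((ℝ ∙ (x - 0))ᗮ.reflection : E →L[ℝ] E) : E →ₗ[ℝ] E) =
      (-1) ^ Module.finrank ℝ (ℝ ∙ (x - 0))ᗮᗮ := Submodule.det_reflection _
  rw [ContinuousLinearMap.det, ContinuousLinearMap.toLinearMap_smul, LinearMap.det_smul, h,
    abs_mul, abs_neg_one_pow, mul_one, dist_zero_right, ← pow_mul,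
    abs_of_nonneg ((even_two_mul _).pow_nonneg _)]

variable [MeasurableSpace E] [BorelSpace E]

theorem integrableOn_compl_closedBall_iff {lam : ℝ} (hlam : 0 < lam) (F : E → ℝ) :
    IntegrableOn F (closedBall 0 lam)ᶜ ↔
      IntegrableOn (fun z => (lam / ‖z‖) ^ (2 * Module.finrank ℝ E) * F (inversion 0 lam z))
        (ball 0 lam \ {0}) := by
  rw [← inversion_image_ball hlam, integrableOn_image_iff_integrableOn_abs_det_fderiv_smul volume
    (measurableSet_ball.diff (measurableSet_singleton _))
    (fun x hx => (hasFDerivAt_inversion hx.2).hasFDerivWithinAt)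
    (inversion_injective _ hlam.ne').injOn]
  simp only [abs_det_fderiv_inversion, smul_eq_mul]

theorem setIntegral_compl_closedBall {lam : ℝ} (hlam : 0 < lam) (F : E → ℝ) :
    ∫ y in (closedBall 0 lam)ᶜ, F y =
      ∫ z in ball 0 lam \ {0},
        (lam / ‖z‖) ^ (2 * Module.finrank ℝ E) * F (inversion 0 lam z) := by
  rw [← inversion_image_ball hlam, integral_image_eq_integral_abs_det_fderiv_smul volume
    (measurableSet_ball.diff (measurableSet_singleton _))
    (fun x hx => (hasFDerivAt_inversion hx.2).hasFDerivWithinAt)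
    (inversion_injective _ hlam.ne').injOn]
  simp only [abs_det_fderiv_inversion, smul_eq_mul]

/-- Riesz potentials of thin spherical shells are uniformly small. -/
theorem exists_shell_potential_le {n R ε : ℝ} (hn0 : 0 < n) (hn : n < Module.finrank ℝ E)
    (hR : 0 < R) (hε : 0 < ε) :
    ∃ η > 0, η < R / 2 ∧ ∀ x : E, ‖x‖ ≤ 2 * R →
      IntegrableOn (fun y => 1 / ‖x - y‖ ^ n) {y : E | |‖y‖ - R| ≤ η} ∧
      ∫ y in {y : E | |‖y‖ - R| ≤ η}, 1 / ‖x - y‖ ^ n ≤ ε := by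
  have hd : 1 ≤ Module.finrank ℝ E := by
    have : (0 : ℝ) < Module.finrank ℝ E := hn0.trans hn
    exact_mod_cast this
  have hmk : Measurable (fun z : E => 1 / ‖z‖ ^ n) := by fun_prop
  have hloc : IntegrableOn (fun z : E => 1 / ‖z‖ ^ n) (ball 0 (5 * R)) :=
    integrableOn_ball_of_norm_le_rpow (C := 1) (α := n) hd hn
      (Eventually.of_forall fun z => by
        rw [Real.norm_of_nonneg (by positivity), Real.rpow_neg (norm_nonneg z), one_mul, one_div])
      hmk.aestronglyMeasurable
  obtain ⟨δ, hδ, hδε⟩ := exists_pos_setLIntegral_lt_of_measure_lt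
    (μ := volume.restrict (ball (0 : E) (5 * R)))
    (f := fun z => ENNReal.ofReal (1 / ‖z‖ ^ n)) hloc.lintegral_lt_top.ne
    (ε := ENNReal.ofReal ε) (by simpa using hε)
  have htend : Tendsto (fun r => volume (cthickening r (sphere (0 : E) R))) (nhds 0) (nhds 0) := by
    have := tendsto_measure_cthickening_of_isClosed (μ := volume) (s := sphere (0 : E) R)
      ⟨1, one_pos, ((isCompact_sphere _ _).cthickening).measure_lt_top.ne⟩ isClosed_sphere
    rwa [Measure.addHaar_sphere_of_ne_zero _ _ hR.ne'] at this
  obtain ⟨η₀, hη₀, hsmall⟩ := Metric.eventually_nhds_iff.1 (htend.eventually (gt_mem_nhds hδ))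
  set η := min (η₀ / 2) (R / 3) with hη
  have hηpos : 0 < η := by positivity
  have hηR : η < R / 2 := (min_le_right _ _).trans_lt (by linarith)
  refine ⟨η, hηpos, hηR, fun x hx => ?_⟩
  set T := {y : E | |‖y‖ - R| ≤ η} with hT
  have hTm : MeasurableSet T := measurableSet_le (by fun_prop) measurable_const
  have hTsub : T ⊆ cthickening η (sphere (0 : E) R) := fun y hy => by
    have hy' : |‖y‖ - R| ≤ η := hy
    have hy0 : 0 < ‖y‖ := by linarith [(abs_le.1 hy').1]
    refine mem_cthickening_of_dist_le y ((R / ‖y‖) • y) _ _ ?_ ?_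
    · rw [mem_sphere_zero_iff_norm, norm_smul, Real.norm_of_nonneg (by positivity)]
      field_simp
    · have : y - (R / ‖y‖) • y = (1 - R / ‖y‖) • y := by module
      rw [dist_eq_norm, this, norm_smul, Real.norm_eq_abs, ← abs_norm y, ← abs_mul, abs_norm]
      rwa [sub_mul, one_mul, div_mul_cancel₀ _ hy0.ne']
  have hTvol : volume T < δ := (measure_mono hTsub).trans_lt (hsmall (by
    rw [dist_zero_right, Real.norm_of_nonneg hηpos.le]
    exact (min_le_left _ _).trans_lt (by linarith)))
  have hmp := Measure.measurePreserving_sub_left (volume : Measure E) x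
  have hpre : (fun y : E => x - y) ⁻¹' ((fun y : E => x - y) ⁻¹' T) = T := by
    ext y; simp
  have hT'm : MeasurableSet ((fun y : E => x - y) ⁻¹' T) := hmp.measurable hTm
  have hT'sub : (fun y : E => x - y) ⁻¹' T ⊆ ball 0 (5 * R) := fun z hz => by
    have hz' : |‖x - z‖ - R| ≤ η := hz
    have h1 := (abs_le.1 hz').2
    have h2 := norm_sub_norm_le z x
    rw [norm_sub_rev] at h2
    rw [mem_ball_zero_iff]; linarith
  have hlint : ∫⁻ y in T, ENNReal.ofReal (1 / ‖x - y‖ ^ n) < ENNReal.ofReal ε := by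
    have h1 := hmp.setLIntegral_comp_preimage hT'm
      (f := fun z => ENNReal.ofReal (1 / ‖z‖ ^ n)) hmk.ennreal_ofReal
    rw [hpre] at h1
    rw [h1]
    have h2 := hδε ((fun y : E => x - y) ⁻¹' T)
      ((Measure.restrict_apply_le _ _).trans_lt
        (by rwa [hmp.measure_preimage hTm.nullMeasurableSet]))
    rwa [Measure.restrict_restrict hT'm, inter_eq_left.2 hT'sub] at h2
  have hmeas : AEStronglyMeasurable (fun y => 1 / ‖x - y‖ ^ n) (volume.restrict T) :=
    (by fun_prop : Measurable (fun y : E => 1 / ‖x - y‖ ^ n)).aestronglyMeasurable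
  have hnn : ∀ y : E, 0 ≤ 1 / ‖x - y‖ ^ n := fun y => by positivity
  refine ⟨⟨hmeas, ?_⟩, ?_⟩
  · rw [hasFiniteIntegral_iff_ofReal (Eventually.of_forall hnn)]
    exact hlint.trans ENNReal.ofReal_lt_top
  · rw [integral_eq_lintegral_of_nonneg_ae (Eventually.of_forall hnn) hmeas]
    exact ENNReal.toReal_le_of_le_ofReal hε.le hlint.le

variable [Nontrivial E]

theorem ball_diff_zero_ae_eq_closedBall (lam : ℝ) :
    (ball (0 : E) lam \ {0} : Set E) =ᵐ[volume] closedBall (0 : E) lam :=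
  (sdiff_null_ae_eq_self (measure_singleton 0)).trans
    (ae_eq_of_subset_of_measure_ge ball_subset_closedBall
      (Measure.addHaar_closedBall_eq_addHaar_ball volume 0 lam).le
      measurableSet_ball.nullMeasurableSet measure_closedBall_lt_top.ne)

/-- Folding the exterior of a ball into its interior in the potential of `f`. -/
theorem potential_eq_setIntegral {n lam : ℝ} (hlam : 0 < lam) {f : E → ℝ} {x : E} (hx : x ≠ 0)
    (hint : Integrable (fun y => f y / ‖x - y‖ ^ n)) :
    IntegrableOn (fun y => f y / ‖x - y‖ ^ n) (ball 0 lam \ {0}) ∧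
    IntegrableOn (fun y => kelvinDensity n lam f y / reflDist lam x y ^ n) (ball 0 lam \ {0}) ∧
    ∫ y, f y / ‖x - y‖ ^ n =
      (∫ y in ball 0 lam \ {0}, f y / ‖x - y‖ ^ n) +
        ∫ y in ball 0 lam \ {0}, kelvinDensity n lam f y / reflDist lam x y ^ n := by
  have hm : MeasurableSet (ball (0 : E) lam \ {0}) :=
    measurableSet_ball.diff (measurableSet_singleton _)
  have hcongr : EqOn (fun z => (lam / ‖z‖) ^ (2 * Module.finrank ℝ E) *
      (f (inversion 0 lam z) / ‖x - inversion 0 lam z‖ ^ n))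
      (fun z => kelvinDensity n lam f z / reflDist lam x z ^ n) (ball 0 lam \ {0}) :=
    fun z hz => inversion_pullback_potential hlam f hx hz.2
  refine ⟨hint.integrableOn, ?_, ?_⟩
  · exact ((integrableOn_compl_closedBall_iff hlam _).1 hint.integrableOn).congr_fun hcongr hm
  · rw [← setIntegral_congr_fun hm hcongr,
      ← setIntegral_compl_closedBall hlam (fun y => f y / ‖x - y‖ ^ n),
      setIntegral_congr_set (ball_diff_zero_ae_eq_closedBall lam),
      integral_add_compl measurableSet_closedBall hint]

/-- The difference between a potential and its Kelvin transform as an integral over a ball. -/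
theorem kelvin_sub_potential {n lam : ℝ} (hlam : 0 < lam) {f v : E → ℝ}
    (hint : ∀ x, Integrable (fun y => f y / ‖x - y‖ ^ n))
    (hv : ∀ x, v x = ∫ y, f y / ‖x - y‖ ^ n) {x : E} (hx : x ≠ 0) :
    IntegrableOn (fun y => (1 / ‖x - y‖ ^ n - 1 / reflDist lam x y ^ n) *
      (kelvinDensity n lam f y - f y)) (ball 0 lam \ {0}) ∧
    (lam / ‖x‖) ^ n * v (inversion 0 lam x) - v x =
      ∫ y in ball 0 lam \ {0}, (1 / ‖x - y‖ ^ n - 1 / reflDist lam x y ^ n) *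
        (kelvinDensity n lam f y - f y) := by
  have hx' := norm_pos_iff.2 hx
  have hpos : 0 < lam / ‖x‖ := by positivity
  have hpow : 0 < (lam / ‖x‖) ^ n := Real.rpow_pos_of_pos hpos n
  obtain ⟨h1, h2, h3⟩ := potential_eq_setIntegral hlam hx (hint x)
  obtain ⟨h4, h5, h6⟩ :=
    potential_eq_setIntegral hlam (inversion_zero_ne_zero hlam hx) (hint (inversion 0 lam x))
  have e4 : ∀ y, (lam / ‖x‖) ^ n * (f y / ‖inversion 0 lam x - y‖ ^ n) =
      f y / reflDist lam x y ^ n := fun y => by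
    rw [norm_inversion_sub hlam hx, Real.mul_rpow hpos.le (reflDist_nonneg hlam x y)]
    field_simp
  have e5 : ∀ y, (lam / ‖x‖) ^ n *
      (kelvinDensity n lam f y / reflDist lam (inversion 0 lam x) y ^ n) =
      kelvinDensity n lam f y / ‖x - y‖ ^ n := fun y => by
    rw [reflDist_inversion hlam, Real.mul_rpow hpos.le (norm_nonneg _)]
    field_simp
  replace h4 := (h4.const_mul ((lam / ‖x‖) ^ n))
  replace h5 := (h5.const_mul ((lam / ‖x‖) ^ n))
  simp only [e4] at h4
  simp only [e5] at h5
  have e : (fun y => (1 / ‖x - y‖ ^ n - 1 / reflDist lam x y ^ n) *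
      (kelvinDensity n lam f y - f y)) = fun y =>
      (f y / reflDist lam x y ^ n + kelvinDensity n lam f y / ‖x - y‖ ^ n) -
        (f y / ‖x - y‖ ^ n + kelvinDensity n lam f y / reflDist lam x y ^ n) := by
    ext y; ring
  have h45 : IntegrableOn (fun y => f y / reflDist lam x y ^ n +
    kelvinDensity n lam f y / ‖x - y‖ ^ n) (ball 0 lam \ {0}) := h4.add h5
  have h12 : IntegrableOn (fun y => f y / ‖x - y‖ ^ n +
    kelvinDensity n lam f y / reflDist lam x y ^ n) (ball 0 lam \ {0}) := h1.add h2
  rw [e]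
  refine ⟨h45.sub h12, ?_⟩
  rw [integral_sub h45 h12, integral_add h4 h5, integral_add h1 h2, hv x, h3,
    hv (inversion 0 lam x), h6, mul_add, ← integral_const_mul, ← integral_const_mul]
  simp only [e4, e5]

/-- If `f` lies strictly below its Kelvin density in a punctured ball, the Kelvin transform of its
potential exceeds the potential by a definite amount in every smaller concentric ball. -/
theorem exists_pos_add_le_kelvin {n lam r : ℝ} (hn : 0 < n) (hlam : 0 < lam) (hrl : r < lam)
    {f v : E → ℝ} (hint : ∀ x, Integrable (fun y => f y / ‖x - y‖ ^ n))
    (hv : ∀ x, v x = ∫ y, f y / ‖x - y‖ ^ n) (hf : ∀ y, y ≠ 0 → ContinuousAt f y)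
    (hlt : ∀ y, 0 < ‖y‖ → ‖y‖ < lam → f y < kelvinDensity n lam f y) :
    ∃ c > 0, ∀ x, 0 < ‖x‖ → ‖x‖ ≤ r → v x + c ≤ (lam / ‖x‖) ^ n * v (inversion 0 lam x) := by
  obtain ⟨y₀, hy₀⟩ := exists_norm_eq E (c := lam / 2) (by positivity)
  have hy₀0 : y₀ ≠ 0 := norm_pos_iff.1 (by rw [hy₀]; positivity)
  set w := fun y => kelvinDensity n lam f y - f y with hw
  have hw0 : 0 < w y₀ := sub_pos.2 (hlt y₀ (by rw [hy₀]; positivity) (by rw [hy₀]; linarith))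
  have hwc : ContinuousAt w y₀ := (continuousAt_kelvinDensity hlam hf hy₀0).sub (hf y₀ hy₀0)
  obtain ⟨ρ₀, hρ₀, hball⟩ := Metric.eventually_nhds_iff_ball.1
    (hwc.eventually (lt_mem_nhds (half_lt_self hw0)))
  set ρ := min ρ₀ (lam / 4) with hρ
  have hρpos : 0 < ρ := by positivity
  have hB : ∀ y ∈ ball y₀ ρ, w y₀ / 2 ≤ w y ∧ 0 < ‖y‖ ∧ ‖y‖ ≤ 3 * lam / 4 := fun y hy => by
    have h1 : ‖y - y₀‖ < lam / 4 := by
      rw [← dist_eq_norm]; exact (mem_ball.1 hy).trans_le (min_le_right _ _)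
    have h2 := norm_sub_norm_le y y₀
    have h3 := norm_sub_norm_le y₀ y
    rw [norm_sub_rev] at h3
    exact ⟨(hball y (ball_subset_ball (min_le_left _ _) hy)).le, by linarith, by linarith⟩
  obtain ⟨k, hk, hkle⟩ := exists_pos_le_kernel_sub (E := E) (n := n) (lam := lam)
    (r := max r (3 * lam / 4)) hn (le_max_of_le_right (by positivity))
    (max_lt hrl (by linarith))
  have hvol : 0 < volume.real (ball y₀ ρ) :=
    ENNReal.toReal_pos (measure_ball_pos _ _ hρpos).ne' measure_ball_lt_top.ne
  refine ⟨volume.real (ball y₀ ρ) * (k * (w y₀ / 2)), by positivity, fun x hx hxr => ?_⟩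
  obtain ⟨hI, hE⟩ := kelvin_sub_potential hlam hint hv (norm_pos_iff.1 hx)
  have hsub : ball y₀ ρ ⊆ ball 0 lam \ {0} := fun y hy => by
    obtain ⟨-, h1, h2⟩ := hB y hy
    exact ⟨by rw [mem_ball_zero_iff]; linarith, norm_pos_iff.1 h1⟩
  have hm : MeasurableSet (ball (0 : E) lam \ {0}) :=
    measurableSet_ball.diff (measurableSet_singleton _)
  have hne : ∀ᵐ y ∂(volume : Measure E), x ≠ y := by
    filter_upwards [compl_mem_ae_iff.2 (measure_singleton x)] with y hy h
    exact hy h.symm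
  have hstep1 : volume.real (ball y₀ ρ) * (k * (w y₀ / 2)) ≤
      ∫ y in ball y₀ ρ, (1 / ‖x - y‖ ^ n - 1 / reflDist lam x y ^ n) * w y := by
    rw [← smul_eq_mul, ← setIntegral_const]
    refine setIntegral_mono_on_ae (integrableOn_const measure_ball_lt_top.ne) (hI.mono_set hsub)
      measurableSet_ball ?_
    filter_upwards [hne] with y hxy hy
    obtain ⟨h0, h1, h2⟩ := hB y hy
    have := hkle x y (norm_pos_iff.1 hx) (le_max_of_le_left hxr) (le_max_of_le_right h2) hxy
    exact mul_le_mul this h0 (by positivity) (hk.le.trans this)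
  have hstep2 : ∫ y in ball y₀ ρ, (1 / ‖x - y‖ ^ n - 1 / reflDist lam x y ^ n) * w y ≤
      ∫ y in ball 0 lam \ {0}, (1 / ‖x - y‖ ^ n - 1 / reflDist lam x y ^ n) * w y := by
    refine setIntegral_mono_set hI ?_ hsub.eventuallyLE
    filter_upwards [ae_restrict_mem hm, ae_restrict_of_ae hne] with y hy hxy
    have hy' := mem_ball_zero_iff.1 hy.1
    exact mul_nonneg (kernel_sub_nonneg hn.le hlam (norm_pos_iff.1 hx) (by linarith) hy'.le hxy)
      (sub_pos.2 (hlt y (norm_pos_iff.2 hy.2) hy')).le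
  linarith

/-- A narrow region principle for moving spheres: if a potential is dominated by its Kelvin
transform off a thin shell next to the sphere, it is dominated throughout the ball. -/
theorem le_kelvin_of_le_off_shell {n R η lam ε C U : ℝ} (hn : 0 ≤ n) (hη : 0 < η)
    (hηR : η < R / 2) (hlamR : lam ≤ R + η) (hC : 0 ≤ C) (hCε : C * ε ≤ 1 / 2)
    {f v : E → ℝ} (hint : ∀ x, Integrable (fun y => f y / ‖x - y‖ ^ n))
    (hv : ∀ x, v x = ∫ y, f y / ‖x - y‖ ^ n) (hv0 : ∀ x, 0 ≤ v x)
    (hU : ∀ x, ‖x‖ ≤ 2 * R → v x ≤ U)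
    (hshell : ∀ x : E, ‖x‖ ≤ 2 * R →
      IntegrableOn (fun y => 1 / ‖x - y‖ ^ n) {y : E | |‖y‖ - R| ≤ η} ∧
      ∫ y in {y : E | |‖y‖ - R| ≤ η}, 1 / ‖x - y‖ ^ n ≤ ε)
    (hle : ∀ y, 0 < ‖y‖ → ‖y‖ < lam → v y ≤ (lam / ‖y‖) ^ n * v (inversion 0 lam y) →
      f y ≤ kelvinDensity n lam f y)
    (hlip : ∀ y, |‖y‖ - R| ≤ η → ‖y‖ < lam → (lam / ‖y‖) ^ n * v (inversion 0 lam y) < v y →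
      f y - kelvinDensity n lam f y ≤ C * (v y - (lam / ‖y‖) ^ n * v (inversion 0 lam y)))
    (hoff : ∀ y, 0 < ‖y‖ → ‖y‖ < R - η → v y ≤ (lam / ‖y‖) ^ n * v (inversion 0 lam y))
    {x : E} (hx : 0 < ‖x‖) (hxlam : ‖x‖ < lam) :
    v x ≤ (lam / ‖x‖) ^ n * v (inversion 0 lam x) := by
  have hlam : 0 < lam := hx.trans hxlam
  have hU0 : 0 ≤ U := (hv0 0).trans (hU 0 (by rw [norm_zero]; linarith))
  have hm : MeasurableSet (ball (0 : E) lam \ {0}) :=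
    measurableSet_ball.diff (measurableSet_singleton _)
  have hTm : MeasurableSet {y : E | |‖y‖ - R| ≤ η} :=
    measurableSet_le (by fun_prop) measurable_const
  have hmain : ∀ S : ℝ, 0 ≤ S → (∀ y, 0 < ‖y‖ → ‖y‖ < lam →
      v y - (lam / ‖y‖) ^ n * v (inversion 0 lam y) ≤ S) →
      ∀ y, 0 < ‖y‖ → ‖y‖ < lam → v y - (lam / ‖y‖) ^ n * v (inversion 0 lam y) ≤ S / 2 := by
    intro S hS hbound x hx hxlam
    obtain ⟨hI, hE⟩ := kelvin_sub_potential hlam hint hv (norm_pos_iff.1 hx)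
    obtain ⟨hT, hTε⟩ := hshell x (by linarith)
    have hind : Integrable (indicator {y : E | |‖y‖ - R| ≤ η} fun y => 1 / ‖x - y‖ ^ n) :=
      hT.integrable_indicator hTm
    have hind0 : ∀ y, 0 ≤ indicator {y : E | |‖y‖ - R| ≤ η} (fun y => 1 / ‖x - y‖ ^ n) y :=
      indicator_nonneg fun y _ => by positivity
    have hne : ∀ᵐ y ∂(volume : Measure E), x ≠ y := by
      filter_upwards [compl_mem_ae_iff.2 (measure_singleton x)] with y hy h
      exact hy h.symm
    have h1 : ∫ y in ball 0 lam \ {0}, -((1 / ‖x - y‖ ^ n - 1 / reflDist lam x y ^ n) *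
        (kelvinDensity n lam f y - f y)) ≤
        ∫ y in ball 0 lam \ {0},
          C * S * indicator {y : E | |‖y‖ - R| ≤ η} (fun y => 1 / ‖x - y‖ ^ n) y := by
      refine setIntegral_mono_on_ae hI.neg (hind.const_mul _).integrableOn hm ?_
      filter_upwards [hne] with y hxy hy
      have hy0 : 0 < ‖y‖ := norm_pos_iff.2 hy.2
      have hylam : ‖y‖ < lam := mem_ball_zero_iff.1 hy.1
      have hk := kernel_sub_nonneg hn hlam (norm_pos_iff.1 hx) hxlam.le hylam.le hxy
      rcases le_or_gt (v y) ((lam / ‖y‖) ^ n * v (inversion 0 lam y)) with h | h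
      · have h2 := mul_nonneg hk (sub_nonneg.2 (hle y hy0 hylam h))
        have h3 := mul_nonneg (mul_nonneg hC hS) (hind0 y)
        linarith
      · have hyT : |‖y‖ - R| ≤ η := by
          rw [abs_le]
          refine ⟨?_, by linarith⟩
          by_contra! hcon
          exact absurd (hoff y hy0 (by linarith)) (not_le.2 h)
        rw [indicator_of_mem (show y ∈ {y : E | |‖y‖ - R| ≤ η} from hyT), ← mul_neg, neg_sub,
          mul_comm (C * S)]
        have h4 := hlip y hyT hylam h
        have h5 : f y - kelvinDensity n lam f y ≤ C * S :=
          h4.trans (mul_le_mul_of_nonneg_left (hbound y hy0 hylam) hC)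
        have h6 : 1 / ‖x - y‖ ^ n - 1 / reflDist lam x y ^ n ≤ 1 / ‖x - y‖ ^ n := by
          have := reflDist_nonneg hlam x y
          have : 0 ≤ 1 / reflDist lam x y ^ n := by positivity
          linarith
        exact (mul_le_mul_of_nonneg_left h5 hk).trans
          (mul_le_mul_of_nonneg_right h6 (mul_nonneg hC hS))
    have h2 : ∫ y in ball 0 lam \ {0},
        C * S * indicator {y : E | |‖y‖ - R| ≤ η} (fun y => 1 / ‖x - y‖ ^ n) y ≤
        C * S * ε := by
      rw [integral_const_mul]
      refine mul_le_mul_of_nonneg_left ?_ (mul_nonneg hC hS)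
      refine (setIntegral_le_integral hind (Eventually.of_forall hind0)).trans ?_
      rwa [integral_indicator hTm]
    rw [integral_neg, ← hE] at h1
    nlinarith
  have hiter : ∀ k : ℕ, ∀ y, 0 < ‖y‖ → ‖y‖ < lam →
      v y - (lam / ‖y‖) ^ n * v (inversion 0 lam y) ≤ U * (1 / 2) ^ k := by
    intro k
    induction k with
    | zero =>
      intro y hy hylam
      have h1 := hU y (by linarith)
      have h2 : 0 ≤ (lam / ‖y‖) ^ n * v (inversion 0 lam y) :=
        mul_nonneg (by positivity) (hv0 _)
      rw [pow_zero]; linarith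
    | succ k ih =>
      intro y hy hylam
      refine (hmain _ (by positivity) ih y hy hylam).trans_eq ?_
      ring
  have hlim : Tendsto (fun k : ℕ => U * (1 / 2 : ℝ) ^ k) atTop (nhds 0) := by
    simpa using (tendsto_pow_atTop_nhds_zero_of_lt_one (r := (1 / 2 : ℝ))
      (by norm_num) (by norm_num)).const_mul U
  have := ge_of_tendsto' hlim fun k => hiter k x hx hxlam
  linarith

omit [FiniteDimensional ℝ E] [MeasurableSpace E] [BorelSpace E] [Nontrivial E] in
theorem kelvin_smul {n L lam : ℝ} (hL : 0 < L) (hlam : 0 < lam) (u : E → ℝ) {x : E}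
    (hx : x ≠ 0) :
    (L / ‖(L ^ 2 / lam ^ 2) • x‖) ^ n * u (inversion 0 L ((L ^ 2 / lam ^ 2) • x)) =
      (lam / L) ^ n * ((lam / ‖x‖) ^ n * u (inversion 0 lam x)) := by
  have hx' := norm_pos_iff.2 hx
  have h1 : ‖(L ^ 2 / lam ^ 2) • x‖ = L ^ 2 / lam ^ 2 * ‖x‖ := by
    rw [norm_smul, Real.norm_of_nonneg (by positivity)]
  have h2 : inversion 0 L ((L ^ 2 / lam ^ 2) • x) = inversion 0 lam x := by
    rw [inversion_zero_eq_smul, inversion_zero_eq_smul, smul_smul, h1]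
    congr 1
    field_simp
  rw [h2, ← mul_assoc, ← Real.mul_rpow (by positivity) (by positivity), h1]
  congr 2
  field_simp

omit [FiniteDimensional ℝ E] [MeasurableSpace E] [BorelSpace E] [Nontrivial E] in
theorem kelvinDensity_henon {n lam α p : ℝ} (hlam : 0 < lam) {u : E → ℝ} (hu : ∀ x, 0 < u x)
    {z : E} (hz : z ≠ 0) :
    kelvinDensity n lam (fun y => ‖y‖ ^ α * u y ^ p) z =
      (lam / ‖z‖) ^ (2 * (Module.finrank ℝ E : ℝ) - n + 2 * α - n * p) *
        (‖z‖ ^ α * ((lam / ‖z‖) ^ n * u (inversion 0 lam z)) ^ p) := by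
  have hz' := norm_pos_iff.2 hz
  have h : 0 < lam / ‖z‖ := by positivity
  have h1 : ‖inversion 0 lam z‖ = (lam / ‖z‖) ^ (2 : ℝ) * ‖z‖ := by
    rw [norm_inversion_zero, Real.rpow_two]
    field_simp
  rw [kelvinDensity, h1, Real.mul_rpow (by positivity) (hu _).le,
    Real.mul_rpow (by positivity) hz'.le, ← Real.rpow_mul h.le, ← Real.rpow_mul h.le,
    Real.rpow_sub h _ (n * p), Real.rpow_add h]
  have : (lam / ‖z‖) ^ (n * p) ≠ 0 := (Real.rpow_pos_of_pos h _).ne'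
  field_simp

/-- The sphere can always be moved past any radius at which the comparison holds. -/
theorem exists_henon_le_kelvin_beyond {n R α p : ℝ} (hn0 : 0 < n) (hn : n < Module.finrank ℝ E)
    (hp1 : 1 < p) (hτ : 0 < 2 * (Module.finrank ℝ E : ℝ) - n + 2 * α - n * p) (hR : 0 < R)
    {u : E → ℝ} (huc : Continuous u) (hu : ∀ x, 0 < u x)
    (hint : ∀ x, Integrable (fun y => ‖y‖ ^ α * u y ^ p / ‖x - y‖ ^ n))
    (hrep : ∀ x, u x = ∫ y, ‖y‖ ^ α * u y ^ p / ‖x - y‖ ^ n)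
    (hle : ∀ x, 0 < ‖x‖ → ‖x‖ < R → u x ≤ (R / ‖x‖) ^ n * u (inversion 0 R x)) :
    ∃ δ > 0, ∀ lam, R ≤ lam → lam < R + δ → ∀ x, 0 < ‖x‖ → ‖x‖ < lam →
      u x ≤ (lam / ‖x‖) ^ n * u (inversion 0 lam x) := by
  have hp0 : 0 < p := one_pos.trans hp1
  set f := fun y : E => ‖y‖ ^ α * u y ^ p with hf
  obtain ⟨U, hU⟩ : ∃ U, ∀ x, ‖x‖ ≤ 2 * R → u x ≤ U := by
    obtain ⟨U, hU⟩ := (isCompact_closedBall (0 : E) (2 * R)).bddAbove_image huc.continuousOn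
    exact ⟨U, fun x hx => hU ⟨x, mem_closedBall_zero_iff.2 hx, rfl⟩⟩
  have hU0 : 0 < U := (hu 0).trans_le (hU 0 (by rw [norm_zero]; linarith))
  obtain ⟨P, hP⟩ : ∃ P, ∀ t ∈ Icc (R / 2) (2 * R), t ^ α ≤ P := by
    obtain ⟨P, hP⟩ := (isCompact_Icc (a := R / 2) (b := 2 * R)).bddAbove_image
      (f := fun t : ℝ => t ^ α) (fun t ht => (Real.continuousAt_rpow_const t α
        (Or.inl (by linarith [ht.1]))).continuousWithinAt)
    exact ⟨P, fun t ht => hP ⟨t, ht, rfl⟩⟩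
  have hP0 : 0 < P := (Real.rpow_pos_of_pos hR α).trans_le (hP R ⟨by linarith, by linarith⟩)
  set C := P * (p * U ^ (p - 1)) with hC
  have hC0 : 0 < C := by positivity
  have hstrict : ∀ lam, ∀ y : E, 0 < ‖y‖ → ‖y‖ < lam →
      ‖y‖ ^ α * ((lam / ‖y‖) ^ n * u (inversion 0 lam y)) ^ p < kelvinDensity n lam f y := by
    intro lam y hy hylam
    have hlam := hy.trans hylam
    have h1 : 0 < (lam / ‖y‖) ^ n * u (inversion 0 lam y) := mul_pos (by positivity) (hu _)
    rw [hf, kelvinDensity_henon hlam hu (norm_pos_iff.1 hy)]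
    refine lt_mul_of_one_lt_left (by positivity) (Real.one_lt_rpow ?_ hτ)
    rwa [one_lt_div hy]
  have hmono : ∀ lam, ∀ y : E, 0 < ‖y‖ → ‖y‖ < lam →
      u y ≤ (lam / ‖y‖) ^ n * u (inversion 0 lam y) → f y < kelvinDensity n lam f y := by
    intro lam y hy hylam h
    refine lt_of_le_of_lt ?_ (hstrict lam y hy hylam)
    exact mul_le_mul_of_nonneg_left (Real.rpow_le_rpow (hu y).le h hp0.le) (by positivity)
  obtain ⟨η, hη, hηR, hshell⟩ := exists_shell_potential_le (E := E) hn0 hn hR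
    (ε := 1 / (2 * C)) (by positivity)
  have hfc : ∀ y, y ≠ 0 → ContinuousAt f y := fun y hy =>
    (continuousAt_id.norm.rpow_const (Or.inl (norm_ne_zero_iff.2 hy))).mul
      (huc.continuousAt.rpow_const (Or.inl (hu y).ne'))
  obtain ⟨c, hc, hgap⟩ := exists_pos_add_le_kelvin (r := R - η) hn0 hR (by linarith) hint hrep hfc
    fun y hy hyR => hmono R y hy hyR (hle y hy hyR)
  have hev : ∀ᶠ lam in nhds R, ∀ x ∈ closedBall (0 : E) R,
      u x < (R / lam) ^ n * (u ((R ^ 2 / lam ^ 2) • x) + c) := by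
    refine (isCompact_closedBall (0 : E) R).eventually_forall_of_forall_eventually fun x _ => ?_
    have hcont : ContinuousAt (fun q : ℝ × E =>
        (R / q.1) ^ n * (u ((R ^ 2 / q.1 ^ 2) • q.2) + c) - u q.2) (R, x) := by
      have h1 : ContinuousAt (fun q : ℝ × E => R / q.1) (R, x) :=
        continuousAt_const.div continuousAt_fst hR.ne'
      have h2 : ContinuousAt (fun q : ℝ × E => (R ^ 2 / q.1 ^ 2) • q.2) (R, x) :=
        (continuousAt_const.div (continuousAt_fst.pow 2) (pow_pos hR 2).ne').smul continuousAt_snd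
      exact ((h1.rpow_const (Or.inr hn0.le)).mul
        ((huc.continuousAt.comp h2).add continuousAt_const)).sub
        (huc.continuousAt.comp continuousAt_snd)
    have hpos : 0 < (R / R) ^ n * (u ((R ^ 2 / R ^ 2) • x) + c) - u x := by
      rw [div_self hR.ne', div_self (pow_pos hR 2).ne', Real.one_rpow, one_smul]
      linarith
    filter_upwards [hcont.eventually (lt_mem_nhds hpos)] with q hq
    exact sub_pos.1 hq
  obtain ⟨δ₀, hδ₀, hδ⟩ := Metric.eventually_nhds_iff.1 hev
  refine ⟨min δ₀ η, by positivity, fun lam hRlam hlam x hx hxlam => ?_⟩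
  have hlam0 : 0 < lam := hR.trans_le hRlam
  have hlam1 : lam < R + δ₀ := hlam.trans_le (by linarith [min_le_left δ₀ η])
  have hlam2 : lam < R + η := hlam.trans_le (by linarith [min_le_right δ₀ η])
  refine le_kelvin_of_le_off_shell hn0.le hη hηR hlam2.le hC0.le
    (by field_simp; exact le_rfl) hint hrep (fun y => (hu y).le) hU hshell
    (fun y hy hylam h => (hmono lam y hy hylam h).le) ?_ ?_ hx hxlam
  · intro y hyT hylam hlt
    have hyT' := abs_le.1 hyT
    have hy : 0 < ‖y‖ := by linarith
    set k := (lam / ‖y‖) ^ n * u (inversion 0 lam y) with hk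
    have hk0 : 0 < k := mul_pos (by positivity) (hu _)
    have huy := hu y
    have hbern := one_add_mul_self_le_rpow_one_add (s := (k - u y) / u y)
      (by rw [le_div_iff₀ huy]; linarith) hp1.le
    have h1 : 1 + (k - u y) / u y = k / u y := by field_simp; ring
    rw [h1, Real.div_rpow hk0.le huy.le, le_div_iff₀ (Real.rpow_pos_of_pos huy p)] at hbern
    have h2 : u y ^ p = u y ^ (p - 1) * u y := by
      rw [← Real.rpow_add_one huy.ne', sub_add_cancel]
    have h3 : u y ^ p - k ^ p ≤ p * u y ^ (p - 1) * (u y - k) := by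
      have : (1 + p * ((k - u y) / u y)) * u y ^ p =
          u y ^ p - p * u y ^ (p - 1) * (u y - k) := by
        rw [h2]; field_simp; ring
      linarith
    have h4 : p * u y ^ (p - 1) * (u y - k) ≤ p * U ^ (p - 1) * (u y - k) := by
      have := Real.rpow_le_rpow huy.le (hU y (by linarith)) (sub_nonneg.2 hp1.le)
      have := sub_pos.2 hlt
      gcongr
    have h5 : ‖y‖ ^ α * (u y ^ p - k ^ p) ≤ P * (p * U ^ (p - 1) * (u y - k)) := by
      refine mul_le_mul (hP _ ⟨by linarith, by linarith⟩) (h3.trans h4) ?_ hP0.le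
      exact sub_nonneg.2 (Real.rpow_le_rpow hk0.le hlt.le hp0.le)
    have h6 := hstrict lam y hy hylam
    calc f y - kelvinDensity n lam f y ≤ ‖y‖ ^ α * u y ^ p - ‖y‖ ^ α * k ^ p := by
          simp only [hf] at h6 ⊢
          linarith
      _ = ‖y‖ ^ α * (u y ^ p - k ^ p) := by ring
      _ ≤ P * (p * U ^ (p - 1) * (u y - k)) := h5
      _ = C * (u y - k) := by rw [hC]; ring
  · intro y hy hyR
    have hratio : R ^ 2 / lam ^ 2 ≤ 1 := by
      rw [div_le_one (by positivity)]; gcongr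
    have hscale : ‖(R ^ 2 / lam ^ 2) • y‖ = R ^ 2 / lam ^ 2 * ‖y‖ := by
      rw [norm_smul, Real.norm_of_nonneg (by positivity)]
    have h1 := hgap ((R ^ 2 / lam ^ 2) • y) (by rw [hscale]; positivity)
      (by rw [hscale]; nlinarith)
    rw [kelvin_smul hR hlam0 u (norm_pos_iff.1 hy)] at h1
    have h2 := hδ (y := lam) (by rw [Real.dist_eq, abs_of_nonneg (by linarith)]; linarith) y
      (mem_closedBall_zero_iff.2 (by linarith))
    refine h2.le.trans ((mul_le_mul_of_nonneg_left h1 (by positivity)).trans_eq ?_)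
    rw [← mul_assoc, ← Real.mul_rpow (by positivity) (by positivity), div_mul_div_cancel₀ hlam0.ne',
      div_self hR.ne', Real.one_rpow, one_mul]

end Inversion

/-- **The critical sphere** (Proposition 3.3): if the moving-spheres supremum
`λ̃ = sup M` is finite, then `u_{λ̃} ≡ u` on `B_{λ̃} \ {0}`. -/
theorem moving_spheres_critical_lambda
    (N : ℕ) (hN : 0 < N) (s α p : ℝ) (hs0 : 0 < s) (hs1 : s < 1)
    (hNs : 2 * s < (N : ℝ)) (hα : -2 * s < α) (hp1 : 1 < p)
    (hp2 : p < ((N : ℝ) + 2 * α + 2 * s) / ((N : ℝ) - 2 * s))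
    (u : EuclideanSpace ℝ (Fin N) → ℝ)
    (hu : AdmissiblePositiveSolution N s α p u)
    (M : Set ℝ)
    (hM : M = {μ : ℝ | 0 < μ ∧ ∀ lam : ℝ, 0 < lam → lam < μ →
      ∀ x : EuclideanSpace ℝ (Fin N), 0 < ‖x‖ → ‖x‖ < lam →
        u x ≤ kelvinTransform N s lam u x})
    (hne : M.Nonempty) (hbdd : BddAbove M) :
    ∀ x : EuclideanSpace ℝ (Fin N), 0 < ‖x‖ → ‖x‖ < sSup M →
      kelvinTransform N s (sSup M) u x = u x := by
  have hNt : Nontrivial (EuclideanSpace ℝ (Fin N)) :=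
    Module.nontrivial_of_finrank_pos (R := ℝ) (by simpa using hN)
  obtain ⟨huc, hu0, -, -, -, -, hrep⟩ := hu
  set R := sSup M with hR
  have hmem : ∀ μ ∈ M, 0 < μ ∧ ∀ lam : ℝ, 0 < lam → lam < μ →
      ∀ x : EuclideanSpace ℝ (Fin N), 0 < ‖x‖ → ‖x‖ < lam →
        u x ≤ kelvinTransform N s lam u x := fun μ hμ => by rwa [hM] at hμ
  have hR0 : 0 < R := by
    obtain ⟨μ, hμ⟩ := hne
    exact (hmem μ hμ).1.trans_le (le_csSup hbdd hμ)
  have hbelow : ∀ lam, 0 < lam → lam < R → ∀ x : EuclideanSpace ℝ (Fin N), 0 < ‖x‖ →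
      ‖x‖ < lam → u x ≤ kelvinTransform N s lam u x := fun lam hlam hlamR => by
    obtain ⟨μ, hμ, hlt⟩ := exists_lt_of_lt_csSup hne hlamR
    exact (hmem μ hμ).2 lam hlam hlt
  have hcrit : ∀ x : EuclideanSpace ℝ (Fin N), 0 < ‖x‖ → ‖x‖ < R →
      u x ≤ kelvinTransform N s R u x := fun x hx hxR => by
    have hcont : Continuous fun lam => kelvinTransform N s lam u x := by
      unfold kelvinTransform
      exact ((continuous_id.div_const _).rpow_const fun _ => Or.inr (by linarith)).mul
        (huc.comp (by fun_prop))
    refine ge_of_tendsto ((hcont.tendsto R).mono_left nhdsWithin_le_nhds :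
      Tendsto _ (nhdsWithin R (Iio R)) _) ?_
    filter_upwards [Ioo_mem_nhdsLT hxR] with lam hlam
    exact hbelow lam (hx.trans hlam.1) hlam.2 x hx hlam.1
  have hτ : 0 < 2 * (Module.finrank ℝ (EuclideanSpace ℝ (Fin N)) : ℝ) - (N - 2 * s) + 2 * α -
      (N - 2 * s) * p := by
    rw [lt_div_iff₀ (by linarith)] at hp2
    rw [finrank_euclideanSpace_fin]
    linarith
  obtain ⟨δ, hδ, hmove⟩ := exists_henon_le_kelvin_beyond (n := N - 2 * s) (by linarith)
    (by rw [finrank_euclideanSpace_fin]; linarith) hp1 hτ hR0 huc hu0 (fun x => (hrep x).1)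
    (fun x => (hrep x).2) (fun x hx hxR => by
      rw [inversion_zero_eq_smul]; exact hcrit x hx hxR)
  have hnew : R + δ ∈ M := by
    rw [hM]
    refine ⟨by linarith, fun lam hlam hlamR x hx hxlam => ?_⟩
    rcases lt_or_ge lam R with h | h
    · exact hbelow lam hlam h x hx hxlam
    · have := hmove lam h hlamR x hx hxlam
      rwa [inversion_zero_eq_smul] at this
  linarith [le_csSup hbdd hnew]
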